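/- arXiv:2604.12589 — 2 statements merged into one kernel-verified Lean document; each statement's English description precedes it below -/
import Mathlib

section
/- Let G be a connected compact metric graph with exponents p̄ and nonlinearities γ_e as above, f = (f_e) with f_e ∈ L^1(0,ℓ_e), and ω : V → ℝ. If v is a weak solution of (P_ω^f) with associated function u ∈ W^{1,p̄}(G), then for every edge e there exist a_e, b_e ∈ ℝ such that v_e is a weak solution of the interval Neumann problem (P^{γ_e,f_e}_{p_e,a_e,b_e}) on (0,ℓ_e) (with the same function u_e), and moreover for every vertex v ∈ V: Σ_{e : ι e = v} a_e + Σ_{e : τ e = v} b_e = ω(v). -/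
open MeasureTheory Set Filter

noncomputable section

/-- A connected compact metric graph: finite nonempty vertex set, finite edge set,
initial/terminal vertex maps without loops, positive edge lengths, no multiple edges,
and connectedness via paths of edges. -/
structure MetricGraph where
  V : Type
  E : Type
  fintypeV : Fintype V
  fintypeE : Fintype E
  nonemptyV : Nonempty V
  ι : E → V
  τ : E → V
  no_loops : ∀ e, ι e ≠ τ e
  len : E → ℝ
  len_pos : ∀ e, 0 < len e
  no_multi : ∀ e e', ({ι e, τ e} : Set V) = ({ι e', τ e'} : Set V) → e = e'
  connected : ∀ v w : V,
    Relation.ReflTransGen (fun a b => ∃ e, (ι e = a ∧ τ e = b) ∨ (ι e = b ∧ τ e = a)) v w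

/-- Sum over the edges of the graph. -/
def edgeSum (G : MetricGraph) (F : G.E → ℝ) : ℝ :=
  letI := G.fintypeE
  ∑ e, F e

/-- Sum over the vertices of the graph. -/
def vertexSum (G : MetricGraph) (F : G.V → ℝ) : ℝ :=
  letI := G.fintypeV
  ∑ v, F v

/-- Number of vertices. -/
def vertexCard (G : MetricGraph) : ℕ :=
  letI := G.fintypeV
  Fintype.card G.V

/-- ρ_p(r) = |r|^(p-2) r. -/
def rho (p r : ℝ) : ℝ := |r| ^ (p - 2) * r

/-- `(u, u')` is in the Sobolev space W^{1,p}(0,ℓ): `u'` is integrable with `|u'|^p`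
integrable on (0,ℓ), and `u` is absolutely continuous on [0,ℓ] with derivative `u'`. -/
def IntervalSobolev (ℓ p : ℝ) (u u' : ℝ → ℝ) : Prop :=
  IntegrableOn u' (Ioo 0 ℓ) volume ∧
  IntegrableOn (fun x => |u' x| ^ p) (Ioo 0 ℓ) volume ∧
  ∀ x ∈ Icc (0:ℝ) ℓ, u x = u 0 + ∫ t in (0:ℝ)..x, u' t

/-- `(u, u')` is in W^{1,p̄}(G), continuous at the vertices with vertex values `uV`. -/
def GraphSobolev (G : MetricGraph) (p : G.E → ℝ) (u u' : G.E → ℝ → ℝ) (uV : G.V → ℝ) : Prop :=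
  (∀ e, IntervalSobolev (G.len e) (p e) (u e) (u' e)) ∧
  (∀ e, u e 0 = uV (G.ι e)) ∧
  (∀ e, u e (G.len e) = uV (G.τ e))

/-- `v` is a weak solution of the graph problem (P_ω^f) with data `u, u', uV`. -/
def SolvesGraphProblem (G : MetricGraph) (p : G.E → ℝ) (γ : G.E → ℝ → ℝ)
    (f : G.E → ℝ → ℝ) (ω : G.V → ℝ)
    (v : G.E → ℝ → ℝ) (u u' : G.E → ℝ → ℝ) (uV : G.V → ℝ) : Prop :=
  (∀ e, IntegrableOn (v e) (Ioo 0 (G.len e)) volume) ∧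
  GraphSobolev G p u u' uV ∧
  (∀ e, ∀ᵐ x ∂(volume.restrict (Ioo 0 (G.len e))), v e x = γ e (u e x)) ∧
  ∀ φ φ' : G.E → ℝ → ℝ, ∀ φV : G.V → ℝ, GraphSobolev G p φ φ' φV →
    edgeSum G (fun e => ∫ x in Ioo 0 (G.len e), v e x * φ e x)
      + edgeSum G (fun e => ∫ x in Ioo 0 (G.len e), rho (p e) (u' e x) * φ' e x)
    = edgeSum G (fun e => ∫ x in Ioo 0 (G.len e), f e x * φ e x)
      + vertexSum G (fun w => ω w * φV w)

/-- `v` is a weak solution of the graph problem (P_ω^f). -/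
def IsGraphWeakSolution (G : MetricGraph) (p : G.E → ℝ) (γ : G.E → ℝ → ℝ)
    (f : G.E → ℝ → ℝ) (ω : G.V → ℝ) (v : G.E → ℝ → ℝ) : Prop :=
  ∃ u u' uV, SolvesGraphProblem G p γ f ω v u u' uV

/-- `v` is a weak solution of the interval Neumann problem (P^{γ,f}_{p,a,b}),
with associated Sobolev function `u` (derivative `u'`). -/
def SolvesNeumann (ℓ p : ℝ) (γ f : ℝ → ℝ) (a b : ℝ) (v u u' : ℝ → ℝ) : Prop :=
  IntegrableOn v (Ioo 0 ℓ) volume ∧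
  IntervalSobolev ℓ p u u' ∧
  (∀ᵐ x ∂(volume.restrict (Ioo 0 ℓ)), v x = γ (u x)) ∧
  ∀ φ φ' : ℝ → ℝ, IntervalSobolev ℓ p φ φ' →
    (∫ x in Ioo 0 ℓ, v x * φ x) + (∫ x in Ioo 0 ℓ, rho p (u' x) * φ' x)
    = (∫ x in Ioo 0 ℓ, f x * φ x) + a * φ 0 + b * φ ℓ

/-- `v` is a weak solution of the interval Neumann problem (P^{γ,f}_{p,a,b}). -/
def IsNeumannWeakSolution (ℓ p : ℝ) (γ f : ℝ → ℝ) (a b : ℝ) (v : ℝ → ℝ) : Prop :=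
  ∃ u u', SolvesNeumann ℓ p γ f a b v u u'

end

/-- Sum of `F e` over the edges `e` satisfying `P e`. -/
noncomputable def edgeSumIf (G : MetricGraph) (P : G.E → Prop) (F : G.E → ℝ) : ℝ :=
  letI : ∀ e, Decidable (P e) := fun e => Classical.propDecidable _
  edgeSum G (fun e => if P e then F e else 0)

theorem abs_rho {p : ℝ} (hp : 1 < p) (r : ℝ) : |rho p r| = |r| ^ (p - 1) := by
  unfold rho
  rw [abs_mul, abs_of_nonneg (Real.rpow_nonneg (abs_nonneg r) _)]
  rcases eq_or_ne r 0 with rfl | hr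
  · simp [Real.zero_rpow (by linarith : p - 1 ≠ 0)]
  · rw [← Real.rpow_add_one (abs_ne_zero.mpr hr)]
    congr 1
    ring

theorem abs_rho_mul_le {p : ℝ} (hp : 1 < p) (r s : ℝ) :
    |rho p r * s| ≤ |r| ^ p + |s| ^ p := by
  have key : ∀ m : ℝ, 0 ≤ m → m ^ (p - 1) * m = m ^ p := by
    intro m hm
    rcases hm.eq_or_lt with rfl | hm
    · simp [Real.zero_rpow (by linarith : p ≠ 0)]
    · rw [← Real.rpow_add_one hm.ne']
      congr 1
      ring
  have hr := abs_nonneg r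
  have hs := abs_nonneg s
  rw [abs_mul, abs_rho hp]
  rcases le_total |s| |r| with h | h
  · calc |r| ^ (p - 1) * |s| ≤ |r| ^ (p - 1) * |r| := by gcongr
      _ = |r| ^ p := key _ hr
      _ ≤ _ := le_add_of_nonneg_right (Real.rpow_nonneg hs p)
  · calc |r| ^ (p - 1) * |s| ≤ |s| ^ (p - 1) * |s| := by gcongr
      _ = |s| ^ p := key _ hs
      _ ≤ _ := le_add_of_nonneg_left (Real.rpow_nonneg hr p)

theorem integrableOn_rho_mul {ℓ p : ℝ} (hp : 1 < p) {w w' φ φ' : ℝ → ℝ}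
    (hw : IntervalSobolev ℓ p w w') (hφ : IntervalSobolev ℓ p φ φ') :
    IntegrableOn (fun x => rho p (w' x) * φ' x) (Ioo 0 ℓ) := by
  have hm : AEMeasurable w' (volume.restrict (Ioo 0 ℓ)) := hw.1.aemeasurable
  have hm' : AEMeasurable φ' (volume.restrict (Ioo 0 ℓ)) := hφ.1.aemeasurable
  refine Integrable.mono' (hw.2.1.add hφ.2.1) ?_ (ae_of_all _ fun x => abs_rho_mul_le hp _ _)
  unfold rho
  exact (((hm.abs.pow_const _).mul hm).mul hm').aestronglyMeasurable

theorem IntervalSobolev.intervalIntegrable {ℓ p : ℝ} {φ φ' : ℝ → ℝ}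
    (h : IntervalSobolev ℓ p φ φ') {x : ℝ} (hx : x ∈ Icc 0 ℓ) :
    IntervalIntegrable φ' volume 0 x := by
  rw [intervalIntegrable_iff_integrableOn_Ioo_of_le hx.1]
  exact h.1.mono_set (Ioo_subset_Ioo_right hx.2)

theorem IntervalSobolev.continuousOn {ℓ p : ℝ} {φ φ' : ℝ → ℝ}
    (h : IntervalSobolev ℓ p φ φ') : ContinuousOn φ (Icc 0 ℓ) := by
  rcases lt_or_ge ℓ 0 with hℓ | hℓ
  · simp [Icc_eq_empty_of_lt hℓ]
  have hprim := intervalIntegral.continuousOn_primitive_interval'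
    (h.intervalIntegrable (right_mem_Icc.mpr hℓ)) left_mem_uIcc
  rw [uIcc_of_le hℓ] at hprim
  exact (continuousOn_const.add hprim).congr h.2.2

theorem IntervalSobolev.integrableOn_mul {ℓ p : ℝ} {g φ φ' : ℝ → ℝ}
    (hg : IntegrableOn g (Ioo 0 ℓ)) (h : IntervalSobolev ℓ p φ φ') :
    IntegrableOn (fun x => g x * φ x) (Ioo 0 ℓ) :=
  (IntegrableOn.mul_continuousOn ((integrableOn_Icc_iff_integrableOn_Ioo).mpr hg)
    h.continuousOn isCompact_Icc).mono_set Ioo_subset_Icc_self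

theorem IntervalSobolev.add_const_mul {ℓ p : ℝ} (hp : 1 < p) {φ φ' ψ ψ' : ℝ → ℝ}
    (hφ : IntervalSobolev ℓ p φ φ') (hψ : IntervalSobolev ℓ p ψ ψ') (c : ℝ) :
    IntervalSobolev ℓ p (fun x => φ x + c * ψ x) (fun x => φ' x + c * ψ' x) := by
  refine ⟨hφ.1.add (hψ.1.const_mul c), ?_, fun x hx => ?_⟩
  · have h0 : ENNReal.ofReal p ≠ 0 := by simpa using by linarith
    have hr : (ENNReal.ofReal p).toReal = p := ENNReal.toReal_ofReal (by linarith)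
    have key : ∀ g : ℝ → ℝ, IntegrableOn g (Ioo 0 ℓ) →
        (IntegrableOn (fun x => |g x| ^ p) (Ioo 0 ℓ) ↔
          MemLp g (ENNReal.ofReal p) (volume.restrict (Ioo 0 ℓ))) := by
      intro g hg
      have := integrable_norm_rpow_iff hg.1 h0 ENNReal.ofReal_ne_top
      rwa [hr] at this
    exact (key _ (hφ.1.add (hψ.1.const_mul c))).mpr
      (((key _ hφ.1).mp hφ.2.1).add (((key _ hψ.1).mp hψ.2.1).const_mul c))
  · beta_reduce
    rw [intervalIntegral.integral_add (hφ.intervalIntegrable hx)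
      ((hψ.intervalIntegrable hx).const_mul c), intervalIntegral.integral_const_mul,
      hφ.2.2 x hx, hψ.2.2 x hx]
    ring

theorem intervalSobolev_affine (ℓ p A B : ℝ) :
    IntervalSobolev ℓ p (fun x => A + B * x) (fun _ => B) := by
  refine ⟨integrableOn_const (by simp), integrableOn_const (by simp), fun x _ => ?_⟩
  simp [mul_comm]

theorem intervalSobolev_zero (ℓ p : ℝ) : IntervalSobolev ℓ p 0 0 := by
  simpa using! intervalSobolev_affine ℓ p 0 0

/-- The difference between the interior terms on the two sides of the weak Neumann formulation. -/
noncomputable def weakResidual (ℓ p : ℝ) (f v w' φ φ' : ℝ → ℝ) : ℝ :=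
  (∫ x in Ioo 0 ℓ, v x * φ x) + (∫ x in Ioo 0 ℓ, rho p (w' x) * φ' x)
    - ∫ x in Ioo 0 ℓ, f x * φ x

theorem weakResidual_add_const_mul {ℓ p : ℝ} (hp : 1 < p) {f v w w' φ φ' ψ ψ' : ℝ → ℝ}
    (hf : IntegrableOn f (Ioo 0 ℓ)) (hv : IntegrableOn v (Ioo 0 ℓ))
    (hw : IntervalSobolev ℓ p w w') (hφ : IntervalSobolev ℓ p φ φ')
    (hψ : IntervalSobolev ℓ p ψ ψ') (c : ℝ) :
    weakResidual ℓ p f v w' (fun x => φ x + c * ψ x) (fun x => φ' x + c * ψ' x)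
      = weakResidual ℓ p f v w' φ φ' + c * weakResidual ℓ p f v w' ψ ψ' := by
  have key : ∀ g φ ψ : ℝ → ℝ, IntegrableOn (fun x => g x * φ x) (Ioo 0 ℓ) →
      IntegrableOn (fun x => g x * ψ x) (Ioo 0 ℓ) →
      ∫ x in Ioo 0 ℓ, g x * (φ x + c * ψ x)
        = (∫ x in Ioo 0 ℓ, g x * φ x) + c * ∫ x in Ioo 0 ℓ, g x * ψ x := by
    intro g φ ψ h₁ h₂
    rw [← integral_const_mul, ← integral_add h₁ (h₂.const_mul c)]
    congr 1
    ext x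
    ring
  unfold weakResidual
  rw [key v φ ψ (hφ.integrableOn_mul hv) (hψ.integrableOn_mul hv),
    key f φ ψ (hφ.integrableOn_mul hf) (hψ.integrableOn_mul hf),
    key (fun x => rho p (w' x)) φ' ψ' (integrableOn_rho_mul hp hw hφ)
      (integrableOn_rho_mul hp hw hψ)]
  ring

theorem weakResidual_zero (ℓ p : ℝ) (f v w' : ℝ → ℝ) : weakResidual ℓ p f v w' 0 0 = 0 := by
  simp [weakResidual]

theorem SolvesGraphProblem.edgeSum_weakResidual {G : MetricGraph} {p : G.E → ℝ}
    {γ : G.E → ℝ → ℝ} {f : G.E → ℝ → ℝ} {ω : G.V → ℝ} {v u u' : G.E → ℝ → ℝ} {uV : G.V → ℝ}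
    (hsol : SolvesGraphProblem G p γ f ω v u u' uV) {φ φ' : G.E → ℝ → ℝ} {φV : G.V → ℝ}
    (hφ : GraphSobolev G p φ φ' φV) :
    edgeSum G (fun e => weakResidual (G.len e) (p e) (f e) (v e) (u' e) (φ e) (φ' e))
      = vertexSum G (fun w => ω w * φV w) := by
  have h := hsol.2.2.2 φ φ' φV hφ
  simp only [edgeSum, weakResidual, Finset.sum_sub_distrib, Finset.sum_add_distrib] at h ⊢
  linarith

theorem SolvesGraphProblem.weakResidual_eq_zero {G : MetricGraph} {p : G.E → ℝ}
    {γ : G.E → ℝ → ℝ} {f : G.E → ℝ → ℝ} {ω : G.V → ℝ} {v u u' : G.E → ℝ → ℝ} {uV : G.V → ℝ}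
    (hsol : SolvesGraphProblem G p γ f ω v u u' uV) (e : G.E) {φ φ' : ℝ → ℝ}
    (hφ : IntervalSobolev (G.len e) (p e) φ φ') (h₀ : φ 0 = 0) (h₁ : φ (G.len e) = 0) :
    weakResidual (G.len e) (p e) (f e) (v e) (u' e) φ φ' = 0 := by
  classical
  have hG : GraphSobolev G p (Pi.single e φ) (Pi.single e φ') 0 := by
    refine ⟨fun e' => ?_, fun e' => ?_, fun e' => ?_⟩ <;>
      rcases eq_or_ne e' e with rfl | he <;>
      simp [*, intervalSobolev_zero]
  have h := hsol.edgeSum_weakResidual hG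
  unfold edgeSum at h
  let := G.fintypeE
  rw [Finset.sum_eq_single e (fun e' _ he => by simp [he, weakResidual_zero])
    (fun h => absurd (Finset.mem_univ e) h)] at h
  simpa [vertexSum] using h

/-- a weak solution of (P_ω^f) restricts on each edge to a weak solution of an
interval Neumann problem (P^{γ_e,f_e}_{p_e,a_e,b_e}) with the same `u_e`, and the boundary
data a_e, b_e satisfy the Kirchhoff relation Σ_{ιe=v} a_e + Σ_{τe=v} b_e = ω(v). -/
theorem graph_solution_edge_decomposition
    (G : MetricGraph) (p : G.E → ℝ) (hp : ∀ e, 1 < p e)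
    (γ : G.E → ℝ → ℝ)
    (hγ : ∀ e, Continuous (γ e) ∧ StrictMono (γ e) ∧ Function.Surjective (γ e) ∧ γ e 0 = 0)
    (f : G.E → ℝ → ℝ) (hf : ∀ e, IntegrableOn (f e) (Ioo 0 (G.len e)) volume)
    (ω : G.V → ℝ) (v u u' : G.E → ℝ → ℝ) (uV : G.V → ℝ)
    (hsol : SolvesGraphProblem G p γ f ω v u u' uV) :
    ∃ a b : G.E → ℝ,
      (∀ e, SolvesNeumann (G.len e) (p e) (γ e) (f e) (a e) (b e) (v e) (u e) (u' e)) ∧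
      (∀ w : G.V,
        edgeSumIf G (fun e => G.ι e = w) a + edgeSumIf G (fun e => G.τ e = w) b = ω w) := by
  classical
  set L : G.E → (ℝ → ℝ) → (ℝ → ℝ) → ℝ := fun e =>
    weakResidual (G.len e) (p e) (f e) (v e) (u' e) with hL
  set a : G.E → ℝ := fun e =>
    L e (fun x => 1 + -(G.len e)⁻¹ * x) (fun _ => -(G.len e)⁻¹) with ha
  set b : G.E → ℝ := fun e => L e (fun x => 0 + (G.len e)⁻¹ * x) (fun _ => (G.len e)⁻¹) with hb
  have key : ∀ e (φ φ' : ℝ → ℝ), IntervalSobolev (G.len e) (p e) φ φ' →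
      L e φ φ' = a e * φ 0 + b e * φ (G.len e) := by
    intro e φ φ' hφ
    have hℓ := (G.len_pos e).ne'
    have hs₀ := intervalSobolev_affine (G.len e) (p e) 1 (-(G.len e)⁻¹)
    have hs₁ := intervalSobolev_affine (G.len e) (p e) 0 (G.len e)⁻¹
    have hs := hφ.add_const_mul (hp e) hs₀ (-φ 0)
    have h := hsol.weakResidual_eq_zero e
      (hs.add_const_mul (hp e) hs₁ (-φ (G.len e))) (by simp) (by simp [hℓ])
    rw [weakResidual_add_const_mul (hp e) (hf e) (hsol.1 e) (hsol.2.1.1 e) hs hs₁,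
      weakResidual_add_const_mul (hp e) (hf e) (hsol.1 e) (hsol.2.1.1 e) hφ hs₀] at h
    simp only [ha, hb, hL]
    linarith
  refine ⟨a, b, fun e => ⟨hsol.1 e, hsol.2.1.1 e, hsol.2.2.1 e, fun φ φ' hφ => ?_⟩, fun w => ?_⟩
  · have h := key e φ φ' hφ
    simp only [hL, weakResidual] at h
    linarith
  · set φV : G.V → ℝ := Pi.single w 1 with hφV
    set φ : G.E → ℝ → ℝ := fun e x =>
      φV (G.ι e) + (φV (G.τ e) - φV (G.ι e)) / G.len e * x with hφ
    set φ' : G.E → ℝ → ℝ := fun e _ => (φV (G.τ e) - φV (G.ι e)) / G.len e with hφ'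
    have hG : GraphSobolev G p φ φ' φV := by
      refine ⟨fun e => intervalSobolev_affine _ _ _ _, fun e => by simp [hφ], fun e => ?_⟩
      have hℓ := (G.len_pos e).ne'
      simp only [hφ]
      field_simp
      ring
    have h := hsol.edgeSum_weakResidual hG
    have hr : ∀ e, weakResidual (G.len e) (p e) (f e) (v e) (u' e) (φ e) (φ' e)
        = (if G.ι e = w then a e else 0) + (if G.τ e = w then b e else 0) := by
      intro e
      have h := key e (φ e) (φ' e) (hG.1 e)
      rw [hG.2.1 e, hG.2.2 e] at h
      rw [hL] at h
      simpa [hφV, Pi.single_apply] using h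
    simp only [hr, edgeSum, vertexSum, Finset.sum_add_distrib] at h
    have hω : ∀ x, ω x * φV x = if x = w then ω x else 0 := by
      intro x
      simp [hφV, Pi.single_apply]
    simp only [hω, Finset.sum_ite_eq', Finset.mem_univ, if_true] at h
    unfold edgeSumIf edgeSum
    convert h
end

section
/- Let ℓ > 0, 1 < p < ∞, γ : ℝ → ℝ continuous, strictly increasing and surjective with γ(0) = 0, f ∈ L^1(0,ℓ) and a, b ∈ ℝ. For ε ∈ ℝ, let v_ε = γ ∘ u_ε denote the weak solution of (P^{γ,f}_{p,a,b+ε}), with u_ε its C¹ representative. Then for every fixed x ∈ [0,ℓ] the map ε ↦ u_ε(x) is continuous on ℝ; moreover u_ε(ℓ) → +∞ as ε → +∞ and u_ε(ℓ) → −∞ as ε → −∞. -/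
open MeasureTheory Set Filter

theorem rho_eq_max_rpow_sub {p : ℝ} (hp : 1 < p) (r : ℝ) :
    rho p r = (max r 0) ^ (p - 1) - (max (-r) 0) ^ (p - 1) := by
  have h0 : (0 : ℝ) ^ (p - 1) = 0 := Real.zero_rpow (by linarith)
  have hpow : ∀ s : ℝ, 0 < s → s ^ (p - 2) * s = s ^ (p - 1) := fun s hs => by
    rw [← Real.rpow_add_one hs.ne']
    ring_nf
  unfold rho
  rcases lt_trichotomy r 0 with h | rfl | h
  · rw [max_eq_right h.le, max_eq_left (by linarith), abs_of_neg h, h0, ← hpow (-r) (by linarith)]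
    ring
  · simp
  · rw [max_eq_left h.le, max_eq_right (by linarith), abs_of_pos h, h0, ← hpow r h]
    ring

theorem continuous_rho {p : ℝ} (hp : 1 < p) : Continuous (rho p) := by
  rw [funext (rho_eq_max_rpow_sub hp)]
  have hp' : 0 ≤ p - 1 := by linarith
  exact ((continuous_id.max continuous_const).rpow_const fun _ => Or.inr hp').sub
    ((continuous_neg.max continuous_const).rpow_const fun _ => Or.inr hp')

theorem strictMono_rho {p : ℝ} (hp : 1 < p) : StrictMono (rho p) := by
  intro x y hxy
  have hp' : 0 < p - 1 := by linarith
  rw [rho_eq_max_rpow_sub hp, rho_eq_max_rpow_sub hp]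
  have h₁ : (max x 0) ^ (p - 1) ≤ (max y 0) ^ (p - 1) :=
    Real.rpow_le_rpow (le_max_right _ _) (max_le_max_right _ hxy.le) hp'.le
  have h₂ : (max (-y) 0) ^ (p - 1) ≤ (max (-x) 0) ^ (p - 1) :=
    Real.rpow_le_rpow (le_max_right _ _) (max_le_max_right _ (neg_le_neg hxy.le)) hp'.le
  rcases lt_or_ge 0 y with hy | hy
  · have : (max x 0) ^ (p - 1) < (max y 0) ^ (p - 1) :=
      Real.rpow_lt_rpow (le_max_right _ _)
        (by rw [max_eq_left hy.le]; exact max_lt hxy hy) hp'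
    linarith
  · have : (max (-y) 0) ^ (p - 1) < (max (-x) 0) ^ (p - 1) :=
      Real.rpow_lt_rpow (le_max_right _ _)
        (by rw [max_eq_left (by linarith : 0 ≤ -x)]; exact max_lt (by linarith) (by linarith)) hp'
    linarith

theorem Monotone.mul_sub_nonneg {h : ℝ → ℝ} (hm : Monotone h) (ξ η : ℝ) :
    0 ≤ (h η - h ξ) * (η - ξ) := by
  rcases le_total ξ η with hle | hle
  · exact mul_nonneg (sub_nonneg.2 (hm hle)) (sub_nonneg.2 hle)
  · exact mul_nonneg_of_nonpos_of_nonpos (sub_nonpos.2 (hm hle)) (sub_nonpos.2 hle)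

/-- A continuous strictly increasing function controls distances on compact sets, up to an
arbitrarily small error. -/
theorem StrictMono.exists_abs_sub_le_add_mul {h : ℝ → ℝ} (hc : Continuous h) (hm : StrictMono h)
    (R : ℝ) {δ : ℝ} (hδ : 0 < δ) :
    ∃ C, 0 ≤ C ∧ ∀ ξ ∈ Icc (-R) R, ∀ η, |η - ξ| ≤ δ + C * ((h η - h ξ) * (η - ξ)) := by
  rcases (Icc (-R) R).eq_empty_or_nonempty with he | hne
  · exact ⟨0, le_rfl, by simp [he]⟩
  obtain ⟨z, -, hz⟩ := isCompact_Icc.exists_isMinOn hne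
    (f := fun ξ => min (h (ξ + δ) - h ξ) (h ξ - h (ξ - δ))) (by fun_prop)
  set c := min (h (z + δ) - h z) (h z - h (z - δ)) with hcdef
  have hcpos : 0 < c :=
    lt_min (sub_pos.2 (hm (by linarith))) (sub_pos.2 (hm (by linarith)))
  refine ⟨c⁻¹, by positivity, fun ξ hξ η => ?_⟩
  have hmin : c ≤ min (h (ξ + δ) - h ξ) (h ξ - h (ξ - δ)) := hz hξ
  rw [le_min_iff] at hmin
  have hnn : 0 ≤ c⁻¹ * ((h η - h ξ) * (η - ξ)) :=
    mul_nonneg (by positivity) (hm.monotone.mul_sub_nonneg ξ η)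
  rcases le_or_gt |η - ξ| δ with hle | hgt
  · linarith
  suffices H : c * |η - ξ| ≤ (h η - h ξ) * (η - ξ) by
    have : |η - ξ| ≤ c⁻¹ * ((h η - h ξ) * (η - ξ)) := by
      rwa [inv_mul_eq_div, le_div_iff₀' hcpos]
    linarith
  rcases lt_abs.1 hgt with hgt | hgt
  · rw [abs_of_pos (by linarith)]
    have := hm.monotone (show ξ + δ ≤ η by linarith)
    exact mul_le_mul_of_nonneg_right (by linarith) (by linarith)
  · rw [abs_of_neg (by linarith)]
    have := hm.monotone (show η ≤ ξ - δ by linarith)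
    nlinarith

/-- A monotone function satisfies a superlinear coercivity estimate on compact sets. -/
theorem Monotone.exists_mul_abs_sub_le_add {h : ℝ → ℝ} (hm : Monotone h) (R : ℝ) {N : ℝ}
    (hN : 0 ≤ N) :
    ∃ K, ∀ ξ ∈ Icc (-R) R, ∀ η, N * |h η - h ξ| ≤ K + (h η - h ξ) * (η - ξ) := by
  refine ⟨N * |h (R + N) - h (-R - N)|, fun ξ hξ η => ?_⟩
  have hnn := hm.mul_sub_nonneg ξ η
  have hK : 0 ≤ N * |h (R + N) - h (-R - N)| := by positivity
  rcases le_or_gt N |η - ξ| with hle | hgt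
  · have : (h η - h ξ) * (η - ξ) = |h η - h ξ| * |η - ξ| := by rw [← abs_mul, abs_of_nonneg hnn]
    have := mul_le_mul_of_nonneg_left hle (abs_nonneg (h η - h ξ))
    linarith
  · obtain ⟨h₁, h₂⟩ := abs_lt.1 hgt
    obtain ⟨h₃, h₄⟩ := hξ
    have a₁ := hm (show η ≤ R + N by linarith)
    have a₂ := hm (show ξ ≤ R + N by linarith)
    have a₃ := hm (show -R - N ≤ η by linarith)
    have a₄ := hm (show -R - N ≤ ξ by linarith)
    have : |h η - h ξ| ≤ |h (R + N) - h (-R - N)| :=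
      (abs_le.2 ⟨by linarith, by linarith⟩ : |h η - h ξ| ≤ h (R + N) - h (-R - N)).trans
        (le_abs_self _)
    have := mul_le_mul_of_nonneg_left this hN
    linarith

theorem exists_mem_Icc_of_continuousOn {ℓ : ℝ} {g : ℝ → ℝ} (hg : ContinuousOn g (Icc 0 ℓ)) :
    ∃ R, ∀ x ∈ Icc 0 ℓ, g x ∈ Icc (-R) R := by
  obtain ⟨R, hR⟩ := isCompact_Icc.exists_bound_of_continuousOn hg
  exact ⟨R, fun x hx => abs_le.1 (hR x hx)⟩

theorem ContinuousOn.integrableOn_Ioo_of_Icc {ℓ : ℝ} {g : ℝ → ℝ} (hg : ContinuousOn g (Icc 0 ℓ)) :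
    IntegrableOn g (Ioo 0 ℓ) volume :=
  hg.integrableOn_Icc.mono_set Ioo_subset_Icc_self

namespace IntervalSobolev

variable {ℓ p : ℝ} {u u' w w' : ℝ → ℝ}

theorem continuousOn_s8 (h : IntervalSobolev ℓ p u u') (hℓ : 0 < ℓ) : ContinuousOn u (Icc 0 ℓ) := by
  have hint : IntegrableOn u' (Icc 0 ℓ) volume :=
    (integrableOn_Icc_iff_integrableOn_Ioo).2 h.1
  have := intervalIntegral.continuousOn_primitive_interval (a := 0) (b := ℓ) (f := u')
    (μ := volume) (by rwa [uIcc_of_le hℓ.le])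
  rw [uIcc_of_le hℓ.le] at this
  exact (continuousOn_const.add this).congr h.2.2

theorem sub_of_continuousOn (hu : IntervalSobolev ℓ p u u') (hw : IntervalSobolev ℓ p w w')
    (hp : 0 ≤ p) (hu' : ContinuousOn u' (Icc 0 ℓ)) (hw' : ContinuousOn w' (Icc 0 ℓ)) :
    IntervalSobolev ℓ p (fun x => u x - w x) (fun x => u' x - w' x) := by
  have hc : ContinuousOn (fun x => u' x - w' x) (Icc 0 ℓ) := hu'.sub hw'
  refine ⟨hc.integrableOn_Ioo_of_Icc,
    (hc.abs.rpow_const fun _ _ => Or.inr hp).integrableOn_Ioo_of_Icc, fun x hx => ?_⟩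
  have hsub : uIcc 0 x ⊆ Icc 0 ℓ := by
    rw [uIcc_of_le hx.1]
    exact Icc_subset_Icc_right hx.2
  simp only
  rw [intervalIntegral.integral_sub (hu'.mono hsub).intervalIntegrable
    (hw'.mono hsub).intervalIntegrable, hu.2.2 x hx, hw.2.2 x hx]
  ring

theorem const_one (ℓ : ℝ) (hp : p ≠ 0) : IntervalSobolev ℓ p (fun _ => 1) (fun _ => 0) := by
  refine ⟨integrableOn_zero, ?_, by simp⟩
  simp [Real.zero_rpow hp]

/-- The one-dimensional Sobolev embedding into the continuous functions. -/
theorem mul_abs_le (h : IntervalSobolev ℓ p u u') (hℓ : 0 < ℓ) {x : ℝ} (hx : x ∈ Icc 0 ℓ) :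
    ℓ * |u x| ≤ (∫ y in Ioo 0 ℓ, |u y|) + ℓ * ∫ y in Ioo 0 ℓ, |u' y| := by
  have hint : IntervalIntegrable u' volume 0 ℓ :=
    (intervalIntegrable_iff_integrableOn_Ioo_of_le hℓ.le).2 h.1
  have hsub : ∀ z ∈ Icc 0 ℓ, IntervalIntegrable u' volume 0 z := fun z hz =>
    hint.mono_set (by rw [uIcc_of_le hz.1, uIcc_of_le hℓ.le]; exact Icc_subset_Icc_right hz.2)
  have key : ∀ y ∈ Ioo 0 ℓ, |u x| ≤ |u y| + ∫ t in Ioo 0 ℓ, |u' t| := fun y hy => by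
    have hy' := Ioo_subset_Icc_self hy
    have hdiff : u x - u y = ∫ t in y..x, u' t := by
      rw [h.2.2 x hx, h.2.2 y hy', ← intervalIntegral.integral_interval_sub_left (hsub x hx)
        (hsub y hy')]
      ring
    have h₁ : |u x - u y| ≤ ∫ t in Ioo 0 ℓ, |u' t| := by
      rw [hdiff, ← Real.norm_eq_abs]
      refine intervalIntegral.norm_integral_le_integral_norm_uIoc.trans ?_
      rw [← integral_Icc_eq_integral_Ioo]
      refine setIntegral_mono_set ((integrableOn_Icc_iff_integrableOn_Ioo).2 h.1.abs)
        (ae_of_all _ fun _ => abs_nonneg _) (LE.le.eventuallyLE ?_)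
      exact uIoc_subset_uIcc.trans (uIcc_subset_Icc hy' hx)
    have := abs_sub_abs_le_abs_sub (u x) (u y)
    linarith
  have hu : IntegrableOn (fun y => |u y|) (Ioo 0 ℓ) volume :=
    (h.continuousOn_s8 hℓ).abs.integrableOn_Ioo_of_Icc
  have hmono := setIntegral_mono_on (μ := volume) (s := Ioo 0 ℓ) (f := fun _ => |u x|)
    (g := fun y => |u y| + ∫ t in Ioo 0 ℓ, |u' t|)
    (by simp) (hu.add (by simp)) measurableSet_Ioo key
  rw [integral_add hu (by simp)] at hmono
  simpa [hℓ.le] using hmono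

end IntervalSobolev

namespace SolvesNeumann

variable {ℓ p a b₁ b₂ : ℝ} {γ f u₁ u₁' u₂ u₂' : ℝ → ℝ}

theorem sub_test (h₁ : SolvesNeumann ℓ p γ f a b₁ (fun x => γ (u₁ x)) u₁ u₁')
    (h₂ : SolvesNeumann ℓ p γ f a b₂ (fun x => γ (u₂ x)) u₂ u₂')
    (hℓ : 0 < ℓ) (hp : 1 < p) (hγ : Continuous γ)
    (hc₁ : ContinuousOn u₁' (Icc 0 ℓ)) (hc₂ : ContinuousOn u₂' (Icc 0 ℓ))
    {φ φ' : ℝ → ℝ} (hφ : IntervalSobolev ℓ p φ φ') (hφ' : ContinuousOn φ' (Icc 0 ℓ)) :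
    (∫ x in Ioo 0 ℓ, (γ (u₂ x) - γ (u₁ x)) * φ x)
      + (∫ x in Ioo 0 ℓ, (rho p (u₂' x) - rho p (u₁' x)) * φ' x) = (b₂ - b₁) * φ ℓ := by
  have hφc := hφ.continuousOn_s8 hℓ
  have e₁ := h₁.2.2.2 φ φ' hφ
  have e₂ := h₂.2.2.2 φ φ' hφ
  have i₁ : IntegrableOn (fun x => γ (u₁ x) * φ x) (Ioo 0 ℓ) volume :=
    ((hγ.comp_continuousOn (h₁.2.1.continuousOn_s8 hℓ)).mul hφc).integrableOn_Ioo_of_Icc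
  have i₂ : IntegrableOn (fun x => γ (u₂ x) * φ x) (Ioo 0 ℓ) volume :=
    ((hγ.comp_continuousOn (h₂.2.1.continuousOn_s8 hℓ)).mul hφc).integrableOn_Ioo_of_Icc
  have j₁ : IntegrableOn (fun x => rho p (u₁' x) * φ' x) (Ioo 0 ℓ) volume :=
    (((continuous_rho hp).comp_continuousOn hc₁).mul hφ').integrableOn_Ioo_of_Icc
  have j₂ : IntegrableOn (fun x => rho p (u₂' x) * φ' x) (Ioo 0 ℓ) volume :=
    (((continuous_rho hp).comp_continuousOn hc₂).mul hφ').integrableOn_Ioo_of_Icc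
  simp only [sub_mul]
  rw [integral_sub i₂ i₁, integral_sub j₂ j₁]
  linarith

theorem energy_identity (h₁ : SolvesNeumann ℓ p γ f a b₁ (fun x => γ (u₁ x)) u₁ u₁')
    (h₂ : SolvesNeumann ℓ p γ f a b₂ (fun x => γ (u₂ x)) u₂ u₂')
    (hℓ : 0 < ℓ) (hp : 1 < p) (hγ : Continuous γ)
    (hc₁ : ContinuousOn u₁' (Icc 0 ℓ)) (hc₂ : ContinuousOn u₂' (Icc 0 ℓ)) :
    (∫ x in Ioo 0 ℓ, (γ (u₂ x) - γ (u₁ x)) * (u₂ x - u₁ x))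
      + (∫ x in Ioo 0 ℓ, (rho p (u₂' x) - rho p (u₁' x)) * (u₂' x - u₁' x))
      = (b₂ - b₁) * (u₂ ℓ - u₁ ℓ) :=
  h₁.sub_test h₂ hℓ hp hγ hc₁ hc₂
    (h₂.2.1.sub_of_continuousOn h₁.2.1 (by linarith) hc₂ hc₁) (hc₂.sub hc₁)

theorem integral_sub_eq (h₁ : SolvesNeumann ℓ p γ f a b₁ (fun x => γ (u₁ x)) u₁ u₁')
    (h₂ : SolvesNeumann ℓ p γ f a b₂ (fun x => γ (u₂ x)) u₂ u₂')
    (hℓ : 0 < ℓ) (hp : 1 < p) (hγ : Continuous γ)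
    (hc₁ : ContinuousOn u₁' (Icc 0 ℓ)) (hc₂ : ContinuousOn u₂' (Icc 0 ℓ)) :
    ∫ x in Ioo 0 ℓ, (γ (u₂ x) - γ (u₁ x)) = b₂ - b₁ := by
  simpa using h₁.sub_test h₂ hℓ hp hγ hc₁ hc₂
    (IntervalSobolev.const_one ℓ (by linarith)) continuousOn_const

/-- Two solutions with different right fluxes are close, up to an arbitrarily small error and a
multiple of the product of the flux difference and the difference of the values at `ℓ`. -/
theorem exists_abs_sub_le (h₁ : SolvesNeumann ℓ p γ f a b₁ (fun x => γ (u₁ x)) u₁ u₁')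
    (hℓ : 0 < ℓ) (hp : 1 < p) (hγ : Continuous γ) (hγm : StrictMono γ)
    (hc₁ : ContinuousOn u₁' (Icc 0 ℓ)) {δ : ℝ} (hδ : 0 < δ) :
    ∃ C, 0 ≤ C ∧ ∀ (b₂ : ℝ) (u₂ u₂' : ℝ → ℝ),
      SolvesNeumann ℓ p γ f a b₂ (fun x => γ (u₂ x)) u₂ u₂' → ContinuousOn u₂' (Icc 0 ℓ) →
      ∀ x ∈ Icc 0 ℓ, |u₂ x - u₁ x| ≤ δ + C * (|b₂ - b₁| * |u₂ ℓ - u₁ ℓ|) := by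
  have hu₁ := h₁.2.1.continuousOn_s8 hℓ
  have hη : 0 < δ / (1 + ℓ) := by positivity
  obtain ⟨R, hR⟩ := exists_mem_Icc_of_continuousOn hu₁
  obtain ⟨R', hR'⟩ := exists_mem_Icc_of_continuousOn hc₁
  obtain ⟨C, hC, hCb⟩ := hγm.exists_abs_sub_le_add_mul hγ R hη
  obtain ⟨C', hC', hCb'⟩ := (strictMono_rho hp).exists_abs_sub_le_add_mul (continuous_rho hp) R' hη
  refine ⟨C / ℓ + C', by positivity, fun b₂ u₂ u₂' h₂ hc₂ x hx => ?_⟩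
  have hu₂ := h₂.2.1.continuousOn_s8 hℓ
  have hE := h₁.energy_identity h₂ hℓ hp hγ hc₁ hc₂
  have iG : IntegrableOn (fun x => (γ (u₂ x) - γ (u₁ x)) * (u₂ x - u₁ x)) (Ioo 0 ℓ) volume :=
    (((hγ.comp_continuousOn hu₂).sub (hγ.comp_continuousOn hu₁)).mul
      (hu₂.sub hu₁)).integrableOn_Ioo_of_Icc
  have iH : IntegrableOn (fun x => (rho p (u₂' x) - rho p (u₁' x)) * (u₂' x - u₁' x))
      (Ioo 0 ℓ) volume :=
    ((((continuous_rho hp).comp_continuousOn hc₂).sub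
      ((continuous_rho hp).comp_continuousOn hc₁)).mul (hc₂.sub hc₁)).integrableOn_Ioo_of_Icc
  set G := ∫ x in Ioo 0 ℓ, (γ (u₂ x) - γ (u₁ x)) * (u₂ x - u₁ x)
  set H := ∫ x in Ioo 0 ℓ, (rho p (u₂' x) - rho p (u₁' x)) * (u₂' x - u₁' x)
  have hG : 0 ≤ G := integral_nonneg fun x => hγm.monotone.mul_sub_nonneg _ _
  have hH : 0 ≤ H := integral_nonneg fun x => (strictMono_rho hp).monotone.mul_sub_nonneg _ _
  have hle : G + H ≤ |b₂ - b₁| * |u₂ ℓ - u₁ ℓ| := by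
    rw [hE, ← abs_mul]
    exact le_abs_self _
  have hw : ∫ y in Ioo 0 ℓ, |u₂ y - u₁ y| ≤ ℓ * (δ / (1 + ℓ)) + C * G := by
    have := setIntegral_mono_on (μ := volume) ((hu₂.sub hu₁).abs.integrableOn_Ioo_of_Icc)
      ((integrableOn_const (C := δ / (1 + ℓ)) (by simp)).add (iG.const_mul C)) measurableSet_Ioo
      fun y hy => hCb _ (hR y (Ioo_subset_Icc_self hy)) (u₂ y)
    simp only [Pi.add_apply] at this
    rw [integral_add (by simp) (iG.const_mul C), integral_const_mul] at this
    simpa [hℓ.le] using this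
  have hw' : ∫ y in Ioo 0 ℓ, |u₂' y - u₁' y| ≤ ℓ * (δ / (1 + ℓ)) + C' * H := by
    have := setIntegral_mono_on (μ := volume) ((hc₂.sub hc₁).abs.integrableOn_Ioo_of_Icc)
      ((integrableOn_const (C := δ / (1 + ℓ)) (by simp)).add (iH.const_mul C')) measurableSet_Ioo
      fun y hy => hCb' _ (hR' y (Ioo_subset_Icc_self hy)) (u₂' y)
    simp only [Pi.add_apply] at this
    rw [integral_add (by simp) (iH.const_mul C'), integral_const_mul] at this
    simpa [hℓ.le] using this
  have hsob := (h₂.2.1.sub_of_continuousOn h₁.2.1 (by linarith) hc₂ hc₁).mul_abs_le hℓ hx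
  set P := |b₂ - b₁| * |u₂ ℓ - u₁ ℓ|
  have hδ' : (δ / (1 + ℓ)) * (1 + ℓ) = δ := div_mul_cancel₀ _ (by positivity)
  have hCP : C * G ≤ C * P := mul_le_mul_of_nonneg_left (by linarith) hC
  have hCP' : C' * H ≤ C' * P := mul_le_mul_of_nonneg_left (by linarith) hC'
  refine le_of_mul_le_mul_left ?_ hℓ
  calc ℓ * |u₂ x - u₁ x|
      ≤ (ℓ * (δ / (1 + ℓ)) + C * P) + ℓ * (ℓ * (δ / (1 + ℓ)) + C' * P) :=
        hsob.trans (add_le_add (by linarith) (mul_le_mul_of_nonneg_left (by linarith) hℓ.le))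
    _ = ℓ * ((δ / (1 + ℓ)) * (1 + ℓ)) + ℓ * ((C / ℓ + C') * P) := by field_simp; ring
    _ = ℓ * (δ + (C / ℓ + C') * P) := by rw [hδ']; ring

/-- The flux difference is controlled, with an arbitrarily large factor, by its product with the
difference of the values at `ℓ`. -/
theorem exists_mul_abs_sub_le (h₁ : SolvesNeumann ℓ p γ f a b₁ (fun x => γ (u₁ x)) u₁ u₁')
    (hℓ : 0 < ℓ) (hp : 1 < p) (hγ : Continuous γ) (hγm : StrictMono γ)
    (hc₁ : ContinuousOn u₁' (Icc 0 ℓ)) {N : ℝ} (hN : 0 ≤ N) :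
    ∃ K, ∀ (b₂ : ℝ) (u₂ u₂' : ℝ → ℝ),
      SolvesNeumann ℓ p γ f a b₂ (fun x => γ (u₂ x)) u₂ u₂' → ContinuousOn u₂' (Icc 0 ℓ) →
      N * |b₂ - b₁| ≤ K + (b₂ - b₁) * (u₂ ℓ - u₁ ℓ) := by
  have hu₁ := h₁.2.1.continuousOn_s8 hℓ
  obtain ⟨R, hR⟩ := exists_mem_Icc_of_continuousOn hu₁
  obtain ⟨K, hK⟩ := hγm.monotone.exists_mul_abs_sub_le_add R hN
  refine ⟨ℓ * K, fun b₂ u₂ u₂' h₂ hc₂ => ?_⟩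
  have hu₂ := h₂.2.1.continuousOn_s8 hℓ
  have hE := h₁.energy_identity h₂ hℓ hp hγ hc₁ hc₂
  have hg : ContinuousOn (fun x => γ (u₂ x) - γ (u₁ x)) (Icc 0 ℓ) :=
    (hγ.comp_continuousOn hu₂).sub (hγ.comp_continuousOn hu₁)
  have iG : IntegrableOn (fun x => (γ (u₂ x) - γ (u₁ x)) * (u₂ x - u₁ x)) (Ioo 0 ℓ) volume :=
    (hg.mul (hu₂.sub hu₁)).integrableOn_Ioo_of_Icc
  have hH : 0 ≤ ∫ x in Ioo 0 ℓ, (rho p (u₂' x) - rho p (u₁' x)) * (u₂' x - u₁' x) :=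
    integral_nonneg fun x => (strictMono_rho hp).monotone.mul_sub_nonneg _ _
  have hmono := setIntegral_mono_on (μ := volume) (hg.abs.integrableOn_Ioo_of_Icc.const_mul N)
    ((integrableOn_const (C := K) (by simp)).add iG) measurableSet_Ioo
    fun y hy => hK _ (hR y (Ioo_subset_Icc_self hy)) (u₂ y)
  simp only [Pi.add_apply] at hmono
  rw [integral_add (by simp) iG, integral_const_mul] at hmono
  have habs : |b₂ - b₁| ≤ ∫ x in Ioo 0 ℓ, |γ (u₂ x) - γ (u₁ x)| := by
    rw [← h₁.integral_sub_eq h₂ hℓ hp hγ hc₁ hc₂]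
    exact abs_integral_le_integral_abs
  have := mul_le_mul_of_nonneg_left habs hN
  have hconst : ∫ _ in Ioo 0 ℓ, K = ℓ * K := by simp [hℓ.le]
  linarith

end SolvesNeumann

/-- Lemma 3.1, point 1(ii): the solution of (P^{γ,f}_{p,a,b+ε}) depends
continuously on ε at every point, and u_ε(ℓ) → ±∞ as ε → ±∞. -/
theorem neumann_perturbed_right_flux_continuity_and_limits
    (ℓ : ℝ) (hℓ : 0 < ℓ) (p : ℝ) (hp : 1 < p)
    (γ : ℝ → ℝ) (hγc : Continuous γ) (hγm : StrictMono γ)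
    (hγs : Function.Surjective γ) (hγ0 : γ 0 = 0)
    (f : ℝ → ℝ) (hf : IntegrableOn f (Ioo 0 ℓ) volume) (a b : ℝ)
    (u u' : ℝ → ℝ → ℝ)
    (hsol : ∀ ε : ℝ,
      SolvesNeumann ℓ p γ f a (b + ε) (fun x => γ (u ε x)) (u ε) (u' ε))
    (hC1 : ∀ ε : ℝ, ContinuousOn (u' ε) (Icc 0 ℓ)) :
    (∀ x ∈ Icc (0:ℝ) ℓ, Continuous (fun ε => u ε x)) ∧
    Tendsto (fun ε => u ε ℓ) atTop atTop ∧
    Tendsto (fun ε => u ε ℓ) atBot atBot := by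
  refine ⟨fun x hx => ?_, ?_, ?_⟩
  · refine Metric.continuous_iff.2 fun ε₀ η hη => ?_
    obtain ⟨C, hC, hb⟩ := (hsol ε₀).exists_abs_sub_le hℓ hp hγc hγm (hC1 ε₀)
      (show 0 < η / 3 by positivity)
    refine ⟨1 / (2 * (C + 1)), by positivity, fun ε hε => ?_⟩
    have hbound := hb _ _ _ (hsol ε) (hC1 ε)
    rw [add_sub_add_left_eq_sub] at hbound
    rw [Real.dist_eq] at hε ⊢
    have hsmall : C * |ε - ε₀| ≤ 1 / 2 := by
      rw [lt_div_iff₀ (by positivity)] at hε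
      nlinarith [abs_nonneg (ε - ε₀)]
    have hend := hbound ℓ ⟨hℓ.le, le_rfl⟩
    have hx' := hbound x hx
    have := mul_le_mul_of_nonneg_right hsmall (abs_nonneg (u ε ℓ - u ε₀ ℓ))
    linarith
  · refine tendsto_atTop.2 fun T => ?_
    obtain ⟨K, hK⟩ := (hsol 0).exists_mul_abs_sub_le hℓ hp hγc hγm (hC1 0)
      (show 0 ≤ |T - u 0 ℓ| + 1 by positivity)
    filter_upwards [eventually_gt_atTop 0, eventually_ge_atTop K] with ε hε hεK
    have h := hK _ _ _ (hsol ε) (hC1 ε)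
    rw [add_sub_add_left_eq_sub, sub_zero, abs_of_pos hε] at h
    by_contra! hlt
    have := mul_lt_mul_of_pos_left
      (show u ε ℓ - u 0 ℓ < |T - u 0 ℓ| by linarith [le_abs_self (T - u 0 ℓ)]) hε
    linarith
  · refine tendsto_atBot.2 fun T => ?_
    obtain ⟨K, hK⟩ := (hsol 0).exists_mul_abs_sub_le hℓ hp hγc hγm (hC1 0)
      (show 0 ≤ |T - u 0 ℓ| + 1 by positivity)
    filter_upwards [eventually_lt_atBot 0, eventually_le_atBot (-K)] with ε hε hεK
    have h := hK _ _ _ (hsol ε) (hC1 ε)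
    rw [add_sub_add_left_eq_sub, sub_zero, abs_of_neg hε] at h
    by_contra! hlt
    have := mul_lt_mul_of_neg_left
      (show -|T - u 0 ℓ| < u ε ℓ - u 0 ℓ by linarith [neg_abs_le (T - u 0 ℓ)]) hε
    linarith
end
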